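/- Let β ∈ Φ with β^ω ≠ 0. Then for every x ∈ E with ω(x) = x: s_{β^ω}(x) = x − (2/(2 − #N(β))) · Σ_{γ ∈ O(β)} (γ^∨, x) γ. -/

import Mathlib

open scoped RealInnerProductSpace

namespace Folding

variable {E : Type*} [NormedAddCommGroup E] [InnerProductSpace ℝ E]

/-- The coroot `α^∨ = 2α/(α,α)` of a nonzero vector `α`. -/
noncomputable def coroot (α : E) : E := (2 / ⟪α, α⟫) • α

/-- The reflection `s_α(x) = x - (α^∨, x) α`. -/
noncomputable def reflVec (α x : E) : E := x - ⟪coroot α, x⟫ • α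

/-- `Φ` is a (finite, not necessarily reduced) root system in `E`. -/
def IsRootSystem (Φ : Set E) : Prop :=
  Φ.Finite ∧ (0 : E) ∉ Φ ∧ Submodule.span ℝ Φ = ⊤ ∧
    (∀ α ∈ Φ, ∀ β ∈ Φ, reflVec α β ∈ Φ) ∧
    ∀ α ∈ Φ, ∀ β ∈ Φ, ∃ n : ℤ, ⟪coroot α, β⟫ = (n : ℝ)

/-- `Φ` is reduced: no root is half of another root. -/
def IsReducedRS (Φ : Set E) : Prop := ∀ α ∈ Φ, (2⁻¹ : ℝ) • α ∉ Φ

/-- `Φ` is irreducible: nonempty and not a disjoint union of two nonempty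
mutually orthogonal subsets. -/
def IsIrreducibleRS (Φ : Set E) : Prop :=
  Φ.Nonempty ∧
    ¬∃ Φ₁ Φ₂ : Set E, Φ₁.Nonempty ∧ Φ₂.Nonempty ∧ Φ₁ ∪ Φ₂ = Φ ∧ Disjoint Φ₁ Φ₂ ∧
      ∀ u ∈ Φ₁, ∀ v ∈ Φ₂, ⟪u, v⟫ = 0

/-- `Δ` is a basis (a set of simple roots) of the root system `Φ`:
it is a vector space basis of `E`, and every root is a linear combination of `Δ`
whose coefficients are all nonnegative integers or all nonpositive integers. -/
def IsBaseRS (Φ : Set E) (Δ : Finset E) : Prop :=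
  ↑Δ ⊆ Φ ∧ LinearIndependent ℝ (fun α : {x : E // x ∈ Δ} => (α : E)) ∧
    Submodule.span ℝ (Δ : Set E) = ⊤ ∧
    ∀ β ∈ Φ, ∃ c : E → ℤ, ((∀ α, 0 ≤ c α) ∨ (∀ α, c α ≤ 0)) ∧
      β = ∑ α ∈ Δ, (c α : ℝ) • α

/-- `ω` belongs to the Weyl group of `Φ`: it is a product of reflections in roots. -/
def InWeylGroup (Φ : Set E) (ω : E ≃ₗᵢ[ℝ] E) : Prop :=
  ∃ l : List E, (∀ α ∈ l, α ∈ Φ) ∧ ∀ x : E, ω x = l.foldr reflVec x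

/-- The average `x^ω = (1/o(ω)) Σ_{t=1}^{o(ω)} ω^t(x)`, where `o(ω)` is the order of `ω`. -/
noncomputable def avg (ω : E ≃ₗᵢ[ℝ] E) (x : E) : E :=
  (orderOf ω : ℝ)⁻¹ • ∑ t ∈ Finset.range (orderOf ω), (ω ^ (t + 1)) x

/-- The fixed-point set `E^ω`. -/
def fixedSet (ω : E ≃ₗᵢ[ℝ] E) : Set E := {x | ω x = x}

/-- The fixed-point subspace `E^ω`. -/
def fixedSubmodule (ω : E ≃ₗᵢ[ℝ] E) : Submodule ℝ E :=
  LinearMap.ker ((ω.toLinearEquiv : E →ₗ[ℝ] E) - LinearMap.id)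

/-- The folded root system `Φ_re^ω = {β^ω : β ∈ Φ, β^ω ≠ 0}`. -/
noncomputable def foldedRoots (Φ : Set E) (ω : E ≃ₗᵢ[ℝ] E) : Set E :=
  {v | v ≠ 0 ∧ ∃ β ∈ Φ, avg ω β = v}

/-- The `⟨ω⟩`-orbit `O(β) = {ω^t(β) : t ∈ ℤ}`. -/
def orbitOf (ω : E ≃ₗᵢ[ℝ] E) (β : E) : Set E := {γ | ∃ t : ℤ, (ω ^ t) β = γ}

/-- `N(β) = {γ ∈ O(β) : γ ≠ ±β, (β,γ) ≠ 0}`. -/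
def nbrOf (ω : E ≃ₗᵢ[ℝ] E) (β : E) : Set E :=
  {γ | γ ∈ orbitOf ω β ∧ γ ≠ β ∧ γ ≠ -β ∧ ⟪β, γ⟫ ≠ 0}


/-- `Δ^ω`: the averages of the simple roots whose `⟨ω⟩`-orbit avoids `α₀ = -htilde`. -/
noncomputable def simpleAvg (Δ : Finset E) (htilde : E) (ω : E ≃ₗᵢ[ℝ] E) : Set E :=
  {v | ∃ α ∈ (Δ : Set E), -htilde ∉ orbitOf ω α ∧ avg ω α = v}

/-- `π̄_S = (Σ_{α ∈ S} ϖ_α^∨)^ω` for a subset `S` of `Δ₀`. -/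
noncomputable def pibar (ω : E ≃ₗᵢ[ℝ] E) (ϖ : E → E) (S : Set E) : E :=
  avg ω (∑ᶠ γ ∈ S, ϖ γ)

end Folding


open Folding

namespace Folding

variable {E : Type*} [NormedAddCommGroup E] [InnerProductSpace ℝ E]

/-! ### Averages and orbits -/

/-- `avg ω` as a linear map. -/
noncomputable def avgHom (ω : E ≃ₗᵢ[ℝ] E) : E →ₗ[ℝ] E :=
  (orderOf ω : ℝ)⁻¹ • ∑ t ∈ Finset.range (orderOf ω),
    ((ω ^ (t + 1) : E ≃ₗᵢ[ℝ] E).toLinearEquiv : E →ₗ[ℝ] E)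

theorem avgHom_apply (ω : E ≃ₗᵢ[ℝ] E) (x : E) : avgHom ω x = avg ω x := by
  simp [avgHom, avg, LinearMap.sum_apply]

theorem orderOf_ne_zero_of_avg_ne_zero {ω : E ≃ₗᵢ[ℝ] E} {x : E} (h : avg ω x ≠ 0) :
    orderOf ω ≠ 0 := by
  intro h0
  simp [avg, h0] at h

theorem avg_neg (ω : E ≃ₗᵢ[ℝ] E) (x : E) : avg ω (-x) = -avg ω x := by
  simp only [← avgHom_apply, map_neg]

theorem sum_pow_apply_map (ω : E ≃ₗᵢ[ℝ] E) (x : E) :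
    ∑ t ∈ Finset.range (orderOf ω), (ω ^ (t + 2)) x =
      ∑ t ∈ Finset.range (orderOf ω), (ω ^ (t + 1)) x := by
  have h := Finset.sum_range_succ' (fun t => (ω ^ (t + 1)) x) (orderOf ω)
  rw [Finset.sum_range_succ] at h
  simpa [pow_succ, pow_orderOf_eq_one] using h.symm

theorem avg_map (ω : E ≃ₗᵢ[ℝ] E) (x : E) : avg ω (ω x) = avg ω x := by
  unfold avg
  rw [← sum_pow_apply_map ω x]
  simp [pow_succ]

theorem map_avg (ω : E ≃ₗᵢ[ℝ] E) (x : E) : ω (avg ω x) = avg ω x := by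
  unfold avg
  rw [map_smul, map_sum, ← sum_pow_apply_map ω x]
  simp [pow_succ']

theorem pow_apply_of_fixed {ω : E ≃ₗᵢ[ℝ] E} {x : E} (hx : ω x = x) (k : ℕ) :
    (ω ^ k) x = x := by
  induction k with
  | zero => simp
  | succ k ih => simp [pow_succ, hx, ih]

theorem avg_pow_apply (ω : E ≃ₗᵢ[ℝ] E) (k : ℕ) (x : E) : avg ω ((ω ^ k) x) = avg ω x := by
  induction k with
  | zero => simp
  | succ k ih => rw [pow_succ', LinearIsometryEquiv.coe_mul, Function.comp_apply, avg_map, ih]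

theorem avg_of_fixed {ω : E ≃ₗᵢ[ℝ] E} (hω : orderOf ω ≠ 0) {x : E} (hx : ω x = x) :
    avg ω x = x := by
  have h : (orderOf ω : ℝ) ≠ 0 := Nat.cast_ne_zero.mpr hω
  simp only [avg, pow_apply_of_fixed hx, Finset.sum_const, Finset.card_range]
  rw [← Nat.cast_smul_eq_nsmul ℝ, smul_smul, inv_mul_cancel₀ h, one_smul]

theorem inner_pow_apply_of_fixed {ω : E ≃ₗᵢ[ℝ] E} {x : E} (hx : ω x = x) (k : ℕ) (y : E) :
    ⟪(ω ^ k) y, x⟫ = ⟪y, x⟫ := by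
  conv_lhs => rw [← pow_apply_of_fixed hx k]
  exact (ω ^ k).inner_map_map y x

theorem inner_avg_of_fixed {ω : E ≃ₗᵢ[ℝ] E} (hω : orderOf ω ≠ 0) {x : E} (hx : ω x = x) (y : E) :
    ⟪avg ω y, x⟫ = ⟪y, x⟫ := by
  have h : (orderOf ω : ℝ) ≠ 0 := Nat.cast_ne_zero.mpr hω
  simp [avg, real_inner_smul_left, sum_inner, inner_pow_apply_of_fixed hx, h]

theorem exists_pow_of_mem_orbitOf {ω : E ≃ₗᵢ[ℝ] E} (hω : orderOf ω ≠ 0) {β γ : E}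
    (h : γ ∈ orbitOf ω β) : ∃ k : ℕ, (ω ^ k) β = γ := by
  obtain ⟨t, rfl⟩ := h
  have hfin : IsOfFinOrder ω := orderOf_ne_zero_iff.mp hω
  obtain ⟨k, hk⟩ := (hfin.mem_powers_iff_mem_zpowers (y := ω ^ t)).mpr ⟨t, rfl⟩
  exact ⟨k, by rw [← hk]⟩

theorem mem_orbitOf_self (ω : E ≃ₗᵢ[ℝ] E) (β : E) : β ∈ orbitOf ω β := ⟨0, by simp⟩

theorem image_orbitOf (ω : E ≃ₗᵢ[ℝ] E) (β : E) : ω '' orbitOf ω β = orbitOf ω β := by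
  ext γ
  constructor
  · rintro ⟨_, ⟨t, rfl⟩, rfl⟩
    exact ⟨1 + t, by simp [zpow_add]⟩
  · rintro ⟨t, rfl⟩
    refine ⟨_, ⟨t - 1, rfl⟩, ?_⟩
    rw [← Function.comp_apply (f := ω), ← LinearIsometryEquiv.coe_mul, ← zpow_one_add]
    simp

theorem sum_orbitOf {ω : E ≃ₗᵢ[ℝ] E} (hω : orderOf ω ≠ 0) {β : E} {O : Finset E}
    (hO : (O : Set E) = orbitOf ω β) : ∑ γ ∈ O, γ = (O.card : ℝ) • avg ω β := by
  classical
  have himage : O.image ω = O := by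
    apply Finset.coe_injective
    rw [Finset.coe_image, hO, image_orbitOf]
  have hfix : ω (∑ γ ∈ O, γ) = ∑ γ ∈ O, γ := by
    rw [map_sum]
    conv_rhs => rw [← himage, Finset.sum_image ω.injective.injOn]
  rw [← avg_of_fixed hω hfix, ← avgHom_apply, map_sum]
  have hconst : ∀ γ ∈ O, avgHom ω γ = avg ω β := by
    intro γ hγ
    obtain ⟨k, rfl⟩ := exists_pow_of_mem_orbitOf hω (hO ▸ Finset.mem_coe.mpr hγ)
    rw [avgHom_apply, avg_pow_apply]
  rw [Finset.sum_congr rfl hconst, Finset.sum_const, Nat.cast_smul_eq_nsmul]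

/-! ### Roots of equal length -/

theorem inner_coroot (α x : E) : ⟪coroot α, x⟫ = 2 * ⟪α, x⟫ / ⟪α, α⟫ := by
  rw [coroot, real_inner_smul_left]
  ring

theorem reflVec_self {α : E} (hα : α ≠ 0) : reflVec α α = -α := by
  have h : ⟪α, α⟫ ≠ 0 := inner_self_ne_zero.mpr hα
  rw [reflVec, inner_coroot, mul_div_cancel_right₀ _ h, two_smul]
  abel

namespace IsRootSystem

variable {Φ : Set E}

theorem ne_zero (hΦ : IsRootSystem Φ) {α : E} (hα : α ∈ Φ) : α ≠ 0 := by
  rintro rfl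
  exact hΦ.2.1 hα

theorem neg_mem (hΦ : IsRootSystem Φ) {α : E} (hα : α ∈ Φ) : -α ∈ Φ := by
  rw [← reflVec_self (hΦ.ne_zero hα)]
  exact hΦ.2.2.2.1 α hα α hα

theorem weyl_mem (hΦ : IsRootSystem Φ) {ω : E ≃ₗᵢ[ℝ] E} (hω : InWeylGroup Φ ω) {α : E}
    (hα : α ∈ Φ) : ω α ∈ Φ := by
  obtain ⟨l, hl, h⟩ := hω
  rw [h]
  clear h
  induction l with
  | nil => exact hα
  | cons a l ih =>
    exact hΦ.2.2.2.1 a (hl a (by simp)) _ (ih fun b hb => hl b (by simp [hb]))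

theorem weyl_pow_mem (hΦ : IsRootSystem Φ) {ω : E ≃ₗᵢ[ℝ] E} (hω : InWeylGroup Φ ω) {α : E}
    (hα : α ∈ Φ) (k : ℕ) : (ω ^ k) α ∈ Φ := by
  induction k with
  | zero => simpa using hα
  | succ k ih => rw [pow_succ']; exact hΦ.weyl_mem hω ih

/-- Two roots of equal length that are not proportional are orthogonal, or form an angle of
`2π/3`, or differ by a root. -/
theorem inner_eq_of_norm_eq (hΦ : IsRootSystem Φ) {β γ : E} (hβ : β ∈ Φ) (hγ : γ ∈ Φ)
    (hnorm : ‖γ‖ = ‖β‖) (hne : γ ≠ β) (hne' : γ ≠ -β) :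
    ⟪β, γ⟫ = 0 ∨ ⟪β, γ⟫ = -(⟪β, β⟫ / 2) ∨ γ - β ∈ Φ := by
  have hpos : 0 < ⟪β, β⟫ := real_inner_self_pos.mpr (hΦ.ne_zero hβ)
  have hγγ : ⟪γ, γ⟫ = ⟪β, β⟫ := by
    rw [real_inner_self_eq_norm_sq, real_inner_self_eq_norm_sq, hnorm]
  have hsub : 0 < ⟪γ - β, γ - β⟫ := real_inner_self_pos.mpr (sub_ne_zero.mpr hne)
  have hadd : 0 < ⟪γ + β, γ + β⟫ :=
    real_inner_self_pos.mpr fun h => hne' (eq_neg_of_add_eq_zero_left h)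
  rw [real_inner_sub_sub_self, hγγ, real_inner_comm β γ] at hsub
  rw [real_inner_add_add_self, hγγ, real_inner_comm β γ] at hadd
  obtain ⟨n, hn⟩ := hΦ.2.2.2.2 β hβ γ hγ
  have hn2 := hn
  rw [inner_coroot, div_eq_iff hpos.ne'] at hn2
  have hlt : (n : ℝ) < 2 := by nlinarith
  have hgt : (-2 : ℝ) < n := by nlinarith
  have hlt' : n < 2 := by exact_mod_cast hlt
  have hgt' : -2 < n := by exact_mod_cast hgt
  obtain rfl | rfl | rfl : n = 0 ∨ n = -1 ∨ n = 1 := by omega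
  · left
    push_cast at hn2
    linarith
  · right; left
    push_cast at hn2
    linarith
  · right; right
    have h := hΦ.2.2.2.1 β hβ γ hγ
    rwa [reflVec, hn, Int.cast_one, one_smul] at h

end IsRootSystem

/-! ### Heights modulo the Coxeter number -/

theorem IsBaseRS.exists_height {Φ : Set E} {Δ : Finset E} (hΔ : IsBaseRS Φ Δ) :
    ∃ f : E →ₗ[ℝ] ℝ, ∀ α ∈ Δ, f α = 1 := by
  have hspan : ⊤ ≤ Submodule.span ℝ (Set.range fun α : {x : E // x ∈ Δ} => (α : E)) := by
    have h : Set.range (fun α : {x : E // x ∈ Δ} => (α : E)) = (Δ : Set E) := by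
      ext; simp
    rw [h, hΔ.2.2.1]
  let b := Module.Basis.mk hΔ.2.1 hspan
  refine ⟨b.constr ℝ fun _ => (1 : ℝ), fun α hα => ?_⟩
  have h := b.constr_basis ℝ (fun _ => (1 : ℝ)) ⟨α, hα⟩
  simpa [b] using h

theorem IsBaseRS.height_ne_zero {Φ : Set E} {Δ : Finset E} (hΦ : IsRootSystem Φ)
    (hΔ : IsBaseRS Φ Δ) {f : E →ₗ[ℝ] ℝ} (hf : ∀ α ∈ Δ, f α = 1) {β : E} (hβ : β ∈ Φ) :
    f β ≠ 0 := by
  obtain ⟨c, hc, hsum⟩ := hΔ.2.2.2 β hβ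
  have hfβ : f β = ∑ α ∈ Δ, (c α : ℝ) := by
    rw [hsum, map_sum]
    exact Finset.sum_congr rfl fun α hα => by simp [hf α hα]
  intro h0
  rw [hfβ] at h0
  have hzero : ∀ α ∈ Δ, (c α : ℝ) = 0 := by
    rcases hc with hc | hc
    · exact (Finset.sum_eq_zero_iff_of_nonneg fun α _ => by exact_mod_cast hc α).mp h0
    · exact (Finset.sum_eq_zero_iff_of_nonpos fun α _ => by exact_mod_cast hc α).mp h0
  refine hΦ.ne_zero hβ ?_
  rw [hsum]
  exact Finset.sum_eq_zero fun α hα => by rw [hzero α hα, zero_smul]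

/-- A map permuting the extended simple roots preserves heights modulo the Coxeter number. -/
theorem IsBaseRS.height_map_sub {Φ : Set E} {Δ : Finset E} (hΔ : IsBaseRS Φ Δ)
    {f : E →ₗ[ℝ] ℝ} (hf : ∀ α ∈ Δ, f α = 1) {θ : E} {ω : E ≃ₗᵢ[ℝ] E}
    (hω : ⇑ω '' (↑Δ ∪ {-θ}) = ↑Δ ∪ {-θ}) {β : E} (hβ : β ∈ Φ) :
    ∃ n : ℤ, f (ω β) - f β = n * (f θ + 1) := by
  have hsimple : ∀ α ∈ Δ, ∃ n : ℤ, f (ω α) - f α = n * (f θ + 1) := by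
    intro α hα
    have hmem : ω α ∈ (↑Δ ∪ {-θ} : Set E) := hω ▸ Set.mem_image_of_mem ω (Or.inl hα)
    rcases hmem with h | h
    · exact ⟨0, by rw [hf _ h, hf α hα]; simp⟩
    · rw [Set.mem_singleton_iff] at h
      refine ⟨-1, ?_⟩
      rw [h, hf α hα, map_neg]
      push_cast
      ring
  choose! n hn using hsimple
  obtain ⟨c, -, hsum⟩ := hΔ.2.2.2 β hβ
  refine ⟨∑ α ∈ Δ, c α * n α, ?_⟩
  rw [hsum]
  simp only [map_sum, map_smul, smul_eq_mul]
  rw [← Finset.sum_sub_distrib, Int.cast_sum, Finset.sum_mul]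
  refine Finset.sum_congr rfl fun α hα => ?_
  rw [← mul_sub, hn α hα]
  push_cast
  ring

/-- The difference of two roots in the same `⟨ω⟩`-orbit is not a root. -/
theorem pow_apply_sub_notMem {Φ : Set E} {Δ : Finset E} (hΦ : IsRootSystem Φ)
    (hΔ : IsBaseRS Φ Δ) {f : E →ₗ[ℝ] ℝ} (hf : ∀ α ∈ Δ, f α = 1) {θ : E}
    (hθ : ∀ β ∈ Φ, f β ≤ f θ) {ω : E ≃ₗᵢ[ℝ] E} (hωW : InWeylGroup Φ ω)
    (hω : ⇑ω '' (↑Δ ∪ {-θ}) = ↑Δ ∪ {-θ}) {β : E} (hβ : β ∈ Φ) (k : ℕ) :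
    (ω ^ k) β - β ∉ Φ := by
  intro hmem
  have hmod : ∃ n : ℤ, f ((ω ^ k) β - β) = n * (f θ + 1) := by
    clear hmem
    induction k with
    | zero => exact ⟨0, by simp⟩
    | succ k ih =>
      obtain ⟨n, hn⟩ := ih
      obtain ⟨m, hm⟩ := hΔ.height_map_sub hf hω (hΦ.weyl_pow_mem hωW hβ k)
      refine ⟨m + n, ?_⟩
      rw [map_sub] at hn ⊢
      rw [pow_succ', LinearIsometryEquiv.coe_mul, Function.comp_apply]
      push_cast
      linarith
  obtain ⟨n, hn⟩ := hmod
  have hne := hΔ.height_ne_zero hΦ hf hmem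
  have hle := hθ _ hmem
  have hge := hθ _ (hΦ.neg_mem hmem)
  rw [map_neg] at hge
  have hn0 : n ≠ 0 := by
    rintro rfl
    simp [hn] at hne
  rw [hn] at hle hge
  have hθ0 : 0 ≤ f θ := by linarith
  rcases lt_or_gt_of_ne hn0 with h | h
  · have h' : (n : ℝ) ≤ -1 := by exact_mod_cast (by omega : n ≤ -1)
    nlinarith
  · have h' : (1 : ℝ) ≤ n := by exact_mod_cast (by omega : 1 ≤ n)
    nlinarith

end Folding

theorem reflection_of_average_on_fixed
    {E : Type*} [NormedAddCommGroup E] [InnerProductSpace ℝ E] [FiniteDimensional ℝ E]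
    (Φ : Set E) (Δ : Finset E) (coeff : E → E → ℝ) (htilde : E) (ω : E ≃ₗᵢ[ℝ] E)
    (hΦrs : IsRootSystem Φ) (hΦred : IsReducedRS Φ) (hΦirr : IsIrreducibleRS Φ)
    (hΔ : IsBaseRS Φ Δ)
    (hcoeff : ∀ β ∈ Φ, β = ∑ α ∈ Δ, coeff β α • α)
    (hht : htilde ∈ Φ)
    (hhighest : ∀ β ∈ Φ, β ≠ htilde → ∑ α ∈ Δ, coeff β α < ∑ α ∈ Δ, coeff htilde α)
    (hωW : InWeylGroup Φ ω)
    (hωΔ₀ : ⇑ω '' (↑Δ ∪ {-htilde}) = ↑Δ ∪ {-htilde}) :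
    ∀ β ∈ Φ, avg ω β ≠ 0 → ∀ x : E, ω x = x →
      reflVec (avg ω β) x =
        x - (2 / (2 - ((nbrOf ω β).ncard : ℝ))) •
          ∑ᶠ γ ∈ orbitOf ω β, ⟪coroot γ, x⟫ • γ := by
  classical
  intro β hβ hb x hx
  have hω := orderOf_ne_zero_of_avg_ne_zero hb
  obtain ⟨f, hf⟩ := hΔ.exists_height
  have hheight : ∀ γ ∈ Φ, f γ = ∑ α ∈ Δ, coeff γ α := by
    intro γ hγ
    conv_lhs => rw [hcoeff γ hγ, map_sum]
    exact Finset.sum_congr rfl fun α hα => by simp [hf α hα]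
  have hθ : ∀ γ ∈ Φ, f γ ≤ f htilde := by
    intro γ hγ
    by_cases h : γ = htilde
    · rw [h]
    · rw [hheight γ hγ, hheight htilde hht]
      exact (hhighest γ hγ h).le
  have horbΦ : orbitOf ω β ⊆ Φ := by
    intro γ hγ
    obtain ⟨k, rfl⟩ := exists_pow_of_mem_orbitOf hω hγ
    exact hΦrs.weyl_pow_mem hωW hβ k
  have hneg : -β ∉ orbitOf ω β := by
    intro h
    obtain ⟨k, hk⟩ := exists_pow_of_mem_orbitOf hω h
    have h' := avg_pow_apply ω k β
    rw [hk, avg_neg] at h'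
    have := IsAddTorsionFree.of_isTorsionFree ℝ E
    exact hb (neg_eq_self.mp h')
  obtain ⟨O, hO⟩ := (hΦrs.1.subset horbΦ).exists_finset_coe
  have hmem : ∀ {γ}, γ ∈ O ↔ γ ∈ orbitOf ω β := by
    intro γ
    rw [← hO, Finset.mem_coe]
  have hβO : β ∈ O := hmem.mpr (mem_orbitOf_self ω β)
  have hββ : 0 < ⟪β, β⟫ := real_inner_self_pos.mpr (hΦrs.ne_zero hβ)
  have hnbr : nbrOf ω β = ((O.erase β).filter fun γ => ⟪β, γ⟫ ≠ 0 : Finset E) := by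
    ext γ
    simp only [nbrOf, Set.mem_ofPred_eq, Finset.coe_filter, Finset.mem_erase, hmem]
    constructor
    · rintro ⟨h1, h2, -, h4⟩
      exact ⟨⟨h2, h1⟩, h4⟩
    · rintro ⟨⟨h2, h1⟩, h4⟩
      exact ⟨h1, h2, fun h => hneg (h ▸ h1), h4⟩
  have hpair : ∀ γ ∈ O.erase β, ⟪β, γ⟫ = if ⟪β, γ⟫ ≠ 0 then -(⟪β, β⟫ / 2) else 0 := by
    intro γ hγ
    obtain ⟨hne, hγO⟩ := Finset.mem_erase.mp hγ
    have hγo := hmem.mp hγO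
    obtain ⟨k, hk⟩ := exists_pow_of_mem_orbitOf hω hγo
    have hnorm : ‖γ‖ = ‖β‖ := by rw [← hk, LinearIsometryEquiv.norm_map]
    rcases hΦrs.inner_eq_of_norm_eq hβ (horbΦ hγo) hnorm hne (fun h => hneg (h ▸ hγo)) with
      h | h | h
    · simp [h]
    · rw [if_pos (by rw [h]; linarith), h]
    · rw [← hk] at h
      exact absurd h (pow_apply_sub_notMem hΦrs hΔ hf hθ hωW hωΔ₀ hβ k)
  have hS := sum_orbitOf hω hO
  have hbb : ⟪avg ω β, avg ω β⟫ = ⟪β, avg ω β⟫ := inner_avg_of_fixed hω (map_avg ω β) β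
  have hbpos : 0 < ⟪avg ω β, avg ω β⟫ := real_inner_self_pos.mpr hb
  have hcard : (O.card : ℝ) * ⟪avg ω β, avg ω β⟫ =
      ⟪β, β⟫ * (2 - ((nbrOf ω β).ncard : ℝ)) / 2 := by
    rw [hbb, ← real_inner_smul_right, ← hS, inner_sum, ← Finset.add_sum_erase O _ hβO,
      Finset.sum_congr rfl hpair, ← Finset.sum_filter, Finset.sum_const, hnbr,
      Set.ncard_coe_finset, nsmul_eq_mul]
    ring
  have hOpos : (0 : ℝ) < O.card := by exact_mod_cast Finset.card_pos.mpr ⟨β, hβO⟩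
  have hN : 0 < 2 - ((nbrOf ω β).ncard : ℝ) := by
    have h := mul_pos hOpos hbpos
    rw [hcard] at h
    exact pos_of_mul_pos_right (by linarith : 0 < ⟪β, β⟫ * _) hββ.le
  have hcoroot : ∀ γ ∈ O, ⟪coroot γ, x⟫ • γ = (2 * ⟪β, x⟫ / ⟪β, β⟫) • γ := by
    intro γ hγ
    obtain ⟨k, rfl⟩ := exists_pow_of_mem_orbitOf hω (hmem.mp hγ)
    rw [inner_coroot, LinearIsometryEquiv.inner_map_map, inner_pow_apply_of_fixed hx]
  rw [reflVec, ← hO, finsum_mem_coe_finset, Finset.sum_congr rfl hcoroot, ← Finset.smul_sum, hS,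
    smul_smul, smul_smul, inner_coroot, inner_avg_of_fixed hω hx]
  congr 2
  rw [eq_comm, eq_div_iff hbpos.ne', mul_assoc, mul_assoc, hcard]
  field_simp
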